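/- Let η > 0 and α ∈ (0,2], and let {W(x)}_{x∈ℝ^d} be a sample-continuous centred Gaussian random field with stationary increments, W(0) = 0 almost surely, and Var(W(x)) = η‖x‖^α for all x ∈ ℝ^d. Define Y(x) = exp(W(x) − η‖x‖^α/2). Then for every b > 0 there exists K > 0 such that for all nonzero h ∈ ℤ^d, E[min{ sup_{x∈[0,1]^d} Y(x), sup_{x∈[h,h+1]} Y(x) }] ≤ K‖h‖^{−b}. -/

import Mathlib

open MeasureTheory ProbabilityTheory Filter Topology
open scoped ENNReal NNReal

noncomputable section

/-- The lattice point `h ∈ ℤ^d` viewed as a point of Euclidean space `ℝ^d`. -/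
def toE {d : ℕ} (h : Fin d → ℤ) : EuclideanSpace ℝ (Fin d) :=
  (EuclideanSpace.equiv (Fin d) ℝ).symm fun i => (h i : ℝ)

/-- The unit cube `[h, h+1] ⊆ ℝ^d` based at a lattice point `h ∈ ℤ^d`. -/
def cube {d : ℕ} (h : Fin d → ℤ) : Set (EuclideanSpace ℝ (Fin d)) :=
  {x | ∀ i, (h i : ℝ) ≤ x i ∧ x i ≤ (h i : ℝ) + 1}


/-- Fernique's theorem with constants depending only on a radius `a` whose ball has mass at
least `3/4`. -/
theorem exists_forall_lintegral_exp_sq_norm_le {a : ℝ} (ha : 0 < a) :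
    ∃ c > (0 : ℝ), ∃ C : ℝ≥0∞, C ≠ ∞ ∧
      ∀ (n : ℕ) (μ : Measure (Fin n → ℝ)) [IsGaussian μ],
        (∀ L : StrongDual ℝ (Fin n → ℝ), μ[L] = 0) →
        ENNReal.ofReal (3 / 4) ≤ μ {x | ‖x‖ ≤ a} →
        ∫⁻ x, ENNReal.ofReal (Real.exp (c * ‖x‖ ^ 2)) ∂μ ≤ C := by
  have hc2 : (2 : ℝ≥0∞)⁻¹ < ENNReal.ofReal (3 / 4) := by
    rw [← ENNReal.ofReal_ofNat 2, ← ENNReal.ofReal_inv_of_pos (by norm_num),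
      ENNReal.ofReal_lt_ofReal_iff (by norm_num)]
    norm_num
  have hc1 : ENNReal.ofReal (3 / 4) < 1 := by
    rw [← ENNReal.ofReal_one, ENNReal.ofReal_lt_ofReal_iff (by norm_num)]
    norm_num
  have hratio : (ENNReal.ofReal (3 / 4) / (1 - ENNReal.ofReal (3 / 4))).toReal = 3 := by
    rw [← ENNReal.ofReal_one, ← ENNReal.ofReal_sub _ (by norm_num), ENNReal.toReal_div,
      ENNReal.toReal_ofReal (by norm_num), ENNReal.toReal_ofReal (by norm_num)]
    norm_num
  refine ⟨Fernique.logRatio (ENNReal.ofReal (3 / 4)) * a⁻¹ ^ 2,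
    mul_pos (Fernique.logRatio_pos hc2 hc1) (by positivity), _, ?_, fun n μ _ h0 hμ =>
    lintegral_exp_mul_sq_norm_le_of_map_rotation_eq_self
      (IsGaussian.map_rotation_eq_self_of_forall_strongDual_eq_zero h0 _) hμ hc2⟩
  refine ENNReal.add_ne_top.2 ⟨ENNReal.ofReal_ne_top, ?_⟩
  rw [hratio]
  have hlog : 0 < Real.log 3 := Real.log_pos (by norm_num)
  refine Summable.tsum_ofReal_ne_top (Summable.of_nonneg_of_le (fun _ => (Real.exp_pos _).le)
    (fun n => ?_) (Real.summable_exp_nat_mul_iff.2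
      (show -(2⁻¹ * Real.log 3) < 0 by linarith)))
  refine Real.exp_le_exp.2 ?_
  have : (n : ℝ) ≤ 2 ^ n := by exact_mod_cast n.lt_two_pow_self.le
  nlinarith

/-- A sequence all of whose finite linear combinations are centred Gaussian has, if it is almost
surely bounded, uniformly bounded exponential moments of its partial suprema. -/
theorem exists_forall_lintegral_exp_norm_le {Ω : Type*} [MeasurableSpace Ω]
    {P : Measure Ω} [IsProbabilityMeasure P] {X : ℕ → Ω → ℝ} (hX : ∀ n, Measurable (X n))
    (hgauss : ∀ (n : ℕ) (c : Fin n → ℝ),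
      ∃ v : ℝ≥0, P.map (fun ω => ∑ i, c i * X i ω) = gaussianReal 0 v)
    (hbdd : ∀ᵐ ω ∂P, ∃ B, ∀ n, |X n ω| ≤ B) (q : ℝ) :
    ∃ C : ℝ≥0∞, C ≠ ∞ ∧ ∀ n : ℕ,
      ∫⁻ ω, ENNReal.ofReal (Real.exp (q * ‖fun i : Fin n => X i ω‖)) ∂P ≤ C := by
  obtain ⟨k, hk⟩ : ∃ k : ℕ, ENNReal.ofReal (3 / 4) < P {ω | ∀ n, |X n ω| ≤ (k : ℝ) + 1} := by
    have hmono : Monotone fun k : ℕ => {ω | ∀ n, |X n ω| ≤ (k : ℝ) + 1} := by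
      intro k l hkl ω hω n
      have : (k : ℝ) ≤ l := by exact_mod_cast hkl
      linarith [hω n]
    have hU : P (⋃ k : ℕ, {ω | ∀ n, |X n ω| ≤ (k : ℝ) + 1}) = 1 := by
      refine (measure_congr (eventuallyEq_univ.2 ?_)).trans measure_univ
      filter_upwards [hbdd] with ω ⟨B, hB⟩
      obtain ⟨k, hk⟩ := exists_nat_ge B
      exact Set.mem_iUnion.2 ⟨k, fun n => by linarith [hB n]⟩
    have ht := tendsto_measure_iUnion_atTop (μ := P) hmono
    rw [hU] at ht
    refine (ht.eventually_const_lt ?_).exists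
    rw [← ENNReal.ofReal_one, ENNReal.ofReal_lt_ofReal_iff (by norm_num)]
    norm_num
  obtain ⟨c, hc, C, hC, hF⟩ :=
    exists_forall_lintegral_exp_sq_norm_le (a := (k : ℝ) + 1) (by positivity)
  refine ⟨ENNReal.ofReal (Real.exp (q ^ 2 / (4 * c))) * C,
    ENNReal.mul_ne_top ENNReal.ofReal_ne_top hC, fun n => ?_⟩
  have hV : Measurable fun ω => fun i : Fin n => X i ω := measurable_pi_lambda _ fun i => hX i
  set μ := P.map fun ω => fun i : Fin n => X i ω with hμ
  have hL (L : StrongDual ℝ (Fin n → ℝ)) : ∃ v : ℝ≥0, μ.map L = gaussianReal 0 v := by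
    obtain ⟨v, hv⟩ := hgauss n fun i => L fun j => if i = j then 1 else 0
    refine ⟨v, ?_⟩
    rw [hμ, Measure.map_map (by fun_prop) hV, ← hv]
    congr 1
    ext ω
    simpa [mul_comm] using L.toLinearMap.pi_apply_eq_sum_univ fun i : Fin n => X i ω
  have : IsGaussian μ := isGaussian_of_map_eq_gaussianReal fun L =>
    let ⟨v, hv⟩ := hL L; ⟨0, v, hv⟩
  have h0 (L : StrongDual ℝ (Fin n → ℝ)) : μ[L] = 0 := by
    obtain ⟨v, hv⟩ := hL L
    have : ∫ y, y ∂(μ.map L) = ∫ x, L x ∂μ :=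
      integral_map (by fun_prop) (by fun_prop)
    rw [← this, hv, integral_id_gaussianReal]
  have hball : ENNReal.ofReal (3 / 4) ≤ μ {x | ‖x‖ ≤ (k : ℝ) + 1} := by
    rw [hμ, Measure.map_apply hV (measurableSet_le measurable_norm measurable_const)]
    refine hk.le.trans (measure_mono fun ω hω => ?_)
    exact (pi_norm_le_iff_of_nonneg (by positivity)).2 fun i => hω i
  have := hF n μ h0 hball
  rw [hμ, lintegral_map (by fun_prop) hV] at this
  refine le_trans ?_ (mul_le_mul_right this _)
  rw [← lintegral_const_mul _ (by fun_prop)]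
  refine lintegral_mono fun ω => ?_
  rw [← ENNReal.ofReal_mul (Real.exp_pos _).le, ← Real.exp_add]
  refine ENNReal.ofReal_le_ofReal (Real.exp_le_exp.2 ?_)
  set t := ‖fun i : Fin n => X i ω‖
  have : q ^ 2 / (4 * c) + c * t ^ 2 - q * t = (q - 2 * c * t) ^ 2 / (4 * c) := by
    field_simp
    ring
  have : 0 ≤ (q - 2 * c * t) ^ 2 / (4 * c) := by positivity
  linarith

/-- Exponential decay in a power of `t` beats every power of `t`. -/
theorem exists_forall_exp_neg_rpow_le {c α b : ℝ} (hc : 0 < c) (hα : 0 < α) (hb : 0 < b) :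
    ∃ K > (0 : ℝ), ∀ t > (0 : ℝ), Real.exp (-(c * t ^ α)) ≤ K * t ^ (-b) := by
  have hβ : 0 < b / α := by positivity
  have hcβ : 0 < c / (b / α) := by positivity
  refine ⟨(c / (b / α)) ^ (-(b / α)), by positivity, fun t ht => ?_⟩
  have hs : 0 < t ^ α := by positivity
  have h1 : c / (b / α) * t ^ α ≤ Real.exp (c / (b / α) * t ^ α) := by
    linarith [Real.add_one_le_exp (c / (b / α) * t ^ α)]
  have h2 := Real.rpow_le_rpow_of_nonpos (by positivity) h1 (neg_nonpos.2 hβ.le)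
  rw [← Real.exp_mul, Real.mul_rpow hcβ.le hs.le, ← Real.rpow_mul ht.le] at h2
  have e1 : c / (b / α) * t ^ α * -(b / α) = -(c * t ^ α) := by field_simp
  have e2 : α * -(b / α) = -b := by field_simp
  rwa [e1, e2] at h2

/-- Moving a point by a bounded amount changes a power of its norm by at most a factor `6 / 5`
and an additive constant. -/
theorem exists_forall_norm_rpow_le {E : Type*} [SeminormedAddCommGroup E] {α : ℝ} (hα : 0 < α)
    (D : ℝ) :
    ∃ C ≥ (0 : ℝ), ∀ x y : E, ‖x - y‖ ≤ D → ‖y‖ ^ α ≤ 6 / 5 * ‖x‖ ^ α + C := by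
  set ρ : ℝ := (5 / 6 : ℝ) ^ α⁻¹ with hρ
  have hρ0 : 0 < ρ := by positivity
  have hρ1 : ρ < 1 := Real.rpow_lt_one (by norm_num) (by norm_num) (by positivity)
  have hρα : ρ ^ α = 5 / 6 := by
    rw [hρ, ← Real.rpow_mul (by norm_num), inv_mul_cancel₀ hα.ne', Real.rpow_one]
  refine ⟨(|D| / (1 - ρ)) ^ α, ?_, fun x y hxy => ?_⟩
  · have : 0 < 1 - ρ := by linarith
    positivity
  have h1ρ : 0 < 1 - ρ := by linarith
  rcases le_total ‖y‖ (|D| / (1 - ρ)) with hy | hy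
  · have := Real.rpow_le_rpow (norm_nonneg y) hy hα.le
    have : 0 ≤ ‖x‖ ^ α := by positivity
    linarith
  · rw [div_le_iff₀ h1ρ] at hy
    have h1 : ‖y‖ - ‖x‖ ≤ D := by
      rw [norm_sub_rev] at hxy
      exact (norm_sub_norm_le y x).trans hxy
    have h2 : ρ * ‖y‖ ≤ ‖x‖ := by linarith [le_abs_self D]
    have h3 := Real.rpow_le_rpow (by positivity) h2 hα.le
    rw [Real.mul_rpow hρ0.le (norm_nonneg _), hρα] at h3
    have : 0 ≤ (|D| / (1 - ρ)) ^ α := by positivity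
    linarith

/-- Young-type bound for the minimum of two exponentials. -/
theorem min_exp_le (m₀ m w s : ℝ) :
    min (Real.exp m₀) (Real.exp (w - s / 2 + m)) ≤
      Real.exp (-(3 / 16) * s) * Real.exp (1 / 2 * w) +
        Real.exp (-(1 / 16) * s) * (Real.exp (2 * m₀) + Real.exp (2 * m)) := by
  have h1 : min (Real.exp m₀) (Real.exp (w - s / 2 + m)) ≤
      Real.exp (-(3 / 32) * s + 1 / 4 * w) *
        Real.exp (-(1 / 32) * s + (3 / 4 * m₀ + 1 / 4 * m)) := by
    rw [← Real.exp_add]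
    rcases le_total m₀ (w - s / 2 + m) with h | h
    · exact (min_le_left _ _).trans (Real.exp_le_exp.2 (by linarith))
    · exact (min_le_right _ _).trans (Real.exp_le_exp.2 (by linarith))
  have h2 (u v : ℝ) : Real.exp u * Real.exp v ≤ Real.exp (2 * u) + Real.exp (2 * v) := by
    have eu : Real.exp (2 * u) = Real.exp u ^ 2 := by rw [← Real.exp_nat_mul]; norm_num
    have ev : Real.exp (2 * v) = Real.exp v ^ 2 := by rw [← Real.exp_nat_mul]; norm_num
    rw [eu, ev]
    nlinarith [sq_nonneg (Real.exp u - Real.exp v), sq_nonneg (Real.exp u),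
      sq_nonneg (Real.exp v)]
  refine h1.trans ((h2 _ _).trans ?_)
  have e1 : Real.exp (2 * (-(3 / 32) * s + 1 / 4 * w)) =
      Real.exp (-(3 / 16) * s) * Real.exp (1 / 2 * w) := by
    rw [← Real.exp_add]; ring_nf
  have e2 : Real.exp (2 * (-(1 / 32) * s + (3 / 4 * m₀ + 1 / 4 * m))) =
      Real.exp (-(1 / 16) * s) * Real.exp (3 / 2 * m₀ + 1 / 2 * m) := by
    rw [← Real.exp_add]; ring_nf
  rw [e1, e2]
  gcongr
  rcases le_total m₀ m with h | h
  · exact (Real.exp_le_exp.2 (by linarith : _ ≤ 2 * m)).trans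
      (le_add_of_nonneg_left (Real.exp_pos _).le)
  · exact (Real.exp_le_exp.2 (by linarith : _ ≤ 2 * m₀)).trans
      (le_add_of_nonneg_right (Real.exp_pos _).le)

theorem isCompact_cube {d : ℕ} (h : Fin d → ℤ) : IsCompact (cube h) := by
  have : cube h = (EuclideanSpace.equiv (Fin d) ℝ) ⁻¹'
      Set.Icc (fun i => (h i : ℝ)) (fun i => (h i : ℝ) + 1) := by
    ext x
    simp [cube, Set.mem_Icc, Pi.le_def, forall_and]
  rw [this]
  exact (EuclideanSpace.equiv (Fin d) ℝ).toHomeomorph.isCompact_preimage.2 isCompact_Icc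

theorem zero_mem_cube_zero {d : ℕ} : (0 : EuclideanSpace ℝ (Fin d)) ∈ cube (0 : Fin d → ℤ) := by
  simp [cube]

theorem sub_toE_mem_cube_zero {d : ℕ} {h : Fin d → ℤ} {x : EuclideanSpace ℝ (Fin d)}
    (hx : x ∈ cube h) : x - toE h ∈ cube (0 : Fin d → ℤ) := by
  intro i
  have := hx i
  simp only [toE, PiLp.sub_apply, Pi.zero_apply, Int.cast_zero]
  constructor <;> simp <;> linarith

theorem toE_ne_zero {d : ℕ} {h : Fin d → ℤ} (hh : h ≠ 0) : toE h ≠ 0 := by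
  contrapose! hh
  ext i
  have := congrArg (fun x : EuclideanSpace ℝ (Fin d) => x i) hh
  simpa [toE] using this

/-- A continuous function on a compact space is bounded by a maximum of its absolute value, which
is controlled by the partial suprema along any dense sequence. -/
theorem exists_abs_le_and_exp_le_iSup {T : Type*} [TopologicalSpace T] [CompactSpace T]
    [Nonempty T] {u : ℕ → T} (hu : DenseRange u) {f : T → ℝ} (hf : Continuous f) {q : ℝ}
    (hq : 0 ≤ q) :
    ∃ m : ℝ, (∀ x, |f x| ≤ m) ∧
      ENNReal.ofReal (Real.exp (q * m)) ≤
        ⨆ n : ℕ, ENNReal.ofReal (Real.exp (q * ‖fun i : Fin n => f (u i)‖)) := by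
  obtain ⟨x₀, -, hx₀⟩ := isCompact_univ.exists_isMaxOn Set.univ_nonempty hf.abs.continuousOn
  refine ⟨|f x₀|, fun x => hx₀ (Set.mem_univ x), ?_⟩
  refine hu.induction_on (p := fun x => ENNReal.ofReal (Real.exp (q * |f x|)) ≤ _) x₀
    (isClosed_le (ENNReal.continuous_ofReal.comp (by fun_prop)) continuous_const) fun k => ?_
  refine le_trans ?_ (le_iSup _ (k + 1))
  refine ENNReal.ofReal_le_ofReal (Real.exp_le_exp.2 (mul_le_mul_of_nonneg_left ?_ hq))
  exact norm_le_pi_norm (fun i : Fin (k + 1) => f (u i)) (Fin.last k)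

/-- The exponential moments of a centred Gaussian variable, expressed through its variance. -/
theorem lintegral_exp_mul_eq_of_map_eq_gaussianReal {Ω : Type*} [MeasurableSpace Ω]
    {P : Measure Ω} {X : Ω → ℝ} (hX : Measurable X) {v : ℝ≥0}
    (hv : P.map X = gaussianReal 0 v) (t : ℝ) :
    ∫⁻ ω, ENNReal.ofReal (Real.exp (t * X ω)) ∂P =
      ENNReal.ofReal (Real.exp (t ^ 2 / 2 * ∫ ω, X ω ^ 2 ∂P)) := by
  have hvar : ∫ ω, X ω ^ 2 ∂P = v := by
    have h1 : ∫ y, y ^ 2 ∂(P.map X) = ∫ ω, X ω ^ 2 ∂P := integral_map (by fun_prop) (by fun_prop)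
    have h2 := variance_fun_id_gaussianReal (μ := 0) (v := v)
    rw [variance_eq_integral measurable_id'.aemeasurable] at h2
    rw [← h1, hv]
    simpa using h2
  have hint : Integrable (fun ω => Real.exp (t * X ω)) P := by
    have := integrable_exp_mul_gaussianReal (μ := 0) (v := v) t
    rw [← hv] at this
    exact this.comp_measurable hX
  rw [← ofReal_integral_eq_lintegral_ofReal hint (ae_of_all _ fun _ => (Real.exp_pos _).le), hvar]
  have := mgf_gaussianReal hv t
  rw [mgf] at this
  rw [this]
  ring_nf

/-- **Decay of the joint spectral tail for the power variogram.**
Let `η > 0`, `α ∈ (0,2]` and let `W` be a sample-continuous centred Gaussian random field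
with stationary increments, `W(0) = 0` a.s., and `Var(W(x)) = η‖x‖^α`. Then the spectral
field `Y(x) = exp(W(x) − η‖x‖^α/2)` satisfies: for every `b > 0` there exists `K > 0` such
that `E[min{sup_{[0,1]^d} Y, sup_{[h,h+1]} Y}] ≤ K‖h‖^{−b}` for all nonzero `h ∈ ℤ^d`. -/
theorem spectral_decay_of_power_variogram
    {d : ℕ} (hd : 0 < d) {Ω : Type*} [MeasurableSpace Ω]
    (P : Measure Ω) [IsProbabilityMeasure P]
    (η α : ℝ) (hη : 0 < η) (hα : 0 < α ∧ α ≤ 2)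
    (W : EuclideanSpace ℝ (Fin d) → Ω → ℝ)
    (hmeas : ∀ x, Measurable (W x))
    -- centred Gaussian random field: every finite linear combination is centred Gaussian
    (hgauss : ∀ (n : ℕ) (x : Fin n → EuclideanSpace ℝ (Fin d)) (c : Fin n → ℝ),
      ∃ v : ℝ≥0, Measure.map (fun ω => ∑ i, c i * W (x i) ω) P = gaussianReal 0 v)
    -- stationary increments
    (hinc : ∀ (x₀ : EuclideanSpace ℝ (Fin d)) (n : ℕ)
      (x : Fin n → EuclideanSpace ℝ (Fin d)),
      Measure.map (fun ω i => W (x i + x₀) ω - W x₀ ω) P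
        = Measure.map (fun ω i => W (x i) ω - W 0 ω) P)
    -- sample continuity
    (hcont : ∀ᵐ ω ∂P, Continuous fun x => W x ω)
    -- W(0) = 0 almost surely
    (hW0 : ∀ᵐ ω ∂P, W 0 ω = 0)
    -- power variogram: Var(W(x)) = η‖x‖^α
    (hvar : ∀ x : EuclideanSpace ℝ (Fin d), ∫ ω, (W x ω) ^ 2 ∂P = η * ‖x‖ ^ α)
    -- the spectral field
    (Y : EuclideanSpace ℝ (Fin d) → Ω → ℝ)
    (hY : ∀ x ω, Y x ω = Real.exp (W x ω - η * ‖x‖ ^ α / 2)) :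
    ∀ b > (0 : ℝ), ∃ K > (0 : ℝ), ∀ h : Fin d → ℤ, h ≠ 0 →
      ∫ ω, min (sSup ((fun x => Y x ω) '' cube (0 : Fin d → ℤ)))
               (sSup ((fun x => Y x ω) '' cube h)) ∂P
        ≤ K * ‖toE h‖ ^ (-b) := by
  have : Nonempty (cube (0 : Fin d → ℤ)) := ⟨⟨0, zero_mem_cube_zero⟩⟩
  have : CompactSpace (cube (0 : Fin d → ℤ)) := isCompact_iff_compactSpace.1 (isCompact_cube 0)
  set u : ℕ → cube (0 : Fin d → ℤ) := TopologicalSpace.denseSeq _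
  have hu : DenseRange u := TopologicalSpace.denseRange_denseSeq _
  -- exponential moments of the suprema of the increments from `p` over the cube based at `p`
  set G : EuclideanSpace ℝ (Fin d) → ℕ → Ω → ℝ≥0∞ := fun p n ω =>
    ENNReal.ofReal (Real.exp (2 * ‖fun i : Fin n => W (u i + p) ω - W p ω‖))
  have hGmeas (p n) : Measurable (G p n) :=
    (by fun_prop : Measurable fun v : Fin n → ℝ => ENNReal.ofReal (Real.exp (2 * ‖v‖))).comp
      (measurable_pi_lambda _ fun i => (hmeas _).sub (hmeas _))
  have hGmono (p) : Monotone (G p) := by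
    intro n k hnk ω
    refine ENNReal.ofReal_le_ofReal (Real.exp_le_exp.2 (mul_le_mul_of_nonneg_left ?_ zero_le_two))
    refine (pi_norm_le_iff_of_nonneg (norm_nonneg _)).2 fun i => ?_
    exact norm_le_pi_norm (fun i : Fin k => W (u i + p) ω - W p ω) (Fin.castLE hnk i)
  have hbdd : ∀ᵐ ω ∂P, ∃ B, ∀ n, |W (u n) ω| ≤ B := by
    filter_upwards [hcont] with ω hω
    obtain ⟨m, hm, -⟩ := exists_abs_le_and_exp_le_iSup hu
      (f := fun x : cube (0 : Fin d → ℤ) => W x ω) (by fun_prop) zero_le_one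
    exact ⟨m, fun n => hm (u n)⟩
  obtain ⟨C₂, hC₂, hmom⟩ := exists_forall_lintegral_exp_norm_le (P := P)
    (X := fun n => W (u n)) (fun n => hmeas _) (fun n c => hgauss n (fun i => u i) c) hbdd 2
  have hGint (p) : ∫⁻ ω, ⨆ n, G p n ω ∂P ≤ C₂ := by
    rw [lintegral_iSup (hGmeas p) (hGmono p)]
    refine iSup_le fun n => ?_
    have hf : Measurable fun v : Fin n → ℝ => ENNReal.ofReal (Real.exp (2 * ‖v‖)) := by fun_prop
    have hlaw := hinc p n fun i => u i
    have h0 : P.map (fun ω (i : Fin n) => W (u i) ω - W 0 ω) =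
        P.map fun ω (i : Fin n) => W (u i) ω := by
      refine Measure.map_congr ?_
      filter_upwards [hW0] with ω hω
      simp [hω]
    rw [h0] at hlaw
    calc ∫⁻ ω, G p n ω ∂P
        = ∫⁻ v, ENNReal.ofReal (Real.exp (2 * ‖v‖))
            ∂(P.map fun ω (i : Fin n) => W (u i + p) ω - W p ω) :=
          (lintegral_map hf
            (measurable_pi_lambda _ fun i => (hmeas _).sub (hmeas _))).symm
      _ ≤ C₂ := by
          rw [hlaw, lintegral_map hf (measurable_pi_lambda _ fun i => hmeas _)]
          exact hmom n
  intro b hb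
  obtain ⟨D, hD⟩ := (isCompact_cube (0 : Fin d → ℤ)).isBounded.exists_norm_le
  obtain ⟨C, hC0, hC⟩ := exists_forall_norm_rpow_le (E := EuclideanSpace ℝ (Fin d)) hα.1 D
  obtain ⟨K, hK0, hK⟩ := exists_forall_exp_neg_rpow_le (c := η / 32) (by positivity) hα.1 hb
  refine ⟨Real.exp (η * C) * (1 + 2 * C₂.toReal) * K, by positivity, fun h hh => ?_⟩
  have hpos : 0 < ‖toE h‖ := norm_pos_iff.2 (toE_ne_zero hh)
  set σ : ℝ := η * ‖toE h‖ ^ α with hσ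
  have hσ0 : 0 ≤ σ := by positivity
  set s : ℝ := 5 / 6 * (σ - η * C) with hs
  have hs_le (x) (hx : x ∈ cube h) : s ≤ η * ‖x‖ ^ α := by
    have := mul_le_mul_of_nonneg_left (hC x (toE h) (hD _ (sub_toE_mem_cube_zero hx))) hη.le
    rw [hs, hσ]
    linarith
  have hae : ∀ᵐ ω ∂P, ENNReal.ofReal (min (sSup ((fun x => Y x ω) '' cube (0 : Fin d → ℤ)))
      (sSup ((fun x => Y x ω) '' cube h))) ≤
      ENNReal.ofReal (Real.exp (-(3 / 16) * s)) *
          ENNReal.ofReal (Real.exp (1 / 2 * W (toE h) ω)) +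
        ENNReal.ofReal (Real.exp (-(1 / 16) * s)) *
          ((⨆ n, G 0 n ω) + ⨆ n, G (toE h) n ω) := by
    filter_upwards [hcont, hW0] with ω hω hω0
    obtain ⟨m₀, hm₀, hm₀G⟩ := exists_abs_le_and_exp_le_iSup hu
      (f := fun x : cube (0 : Fin d → ℤ) => W (x + 0) ω - W 0 ω) (by fun_prop) zero_le_two
    obtain ⟨m, hm, hmG⟩ := exists_abs_le_and_exp_le_iSup hu
      (f := fun x : cube (0 : Fin d → ℤ) => W (x + toE h) ω - W (toE h) ω)
      (by fun_prop) zero_le_two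
    have hA : sSup ((fun x => Y x ω) '' cube (0 : Fin d → ℤ)) ≤ Real.exp m₀ := by
      refine Real.sSup_le ?_ (Real.exp_pos _).le
      rintro _ ⟨x, hx, rfl⟩
      have h1 := (le_abs_self _).trans (hm₀ ⟨x, hx⟩)
      simp only [add_zero, hω0, sub_zero] at h1
      have : 0 ≤ η * ‖x‖ ^ α := by positivity
      simp only [hY]
      exact Real.exp_le_exp.2 (by linarith)
    have hB : sSup ((fun x => Y x ω) '' cube h) ≤ Real.exp (W (toE h) ω - s / 2 + m) := by
      refine Real.sSup_le ?_ (Real.exp_pos _).le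
      rintro _ ⟨x, hx, rfl⟩
      have h1 := (le_abs_self _).trans (hm ⟨x - toE h, sub_toE_mem_cube_zero hx⟩)
      simp only [sub_add_cancel] at h1
      have := hs_le x hx
      simp only [hY]
      exact Real.exp_le_exp.2 (by linarith)
    refine (ENNReal.ofReal_le_ofReal
      ((min_le_min hA hB).trans (min_exp_le _ _ _ _))).trans ?_
    rw [ENNReal.ofReal_add (by positivity) (by positivity), ENNReal.ofReal_mul (by positivity),
      ENNReal.ofReal_mul (by positivity), ENNReal.ofReal_add (by positivity) (by positivity)]
    gcongr
  have hlint : ∫⁻ ω, ENNReal.ofReal (min (sSup ((fun x => Y x ω) '' cube (0 : Fin d → ℤ)))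
      (sSup ((fun x => Y x ω) '' cube h))) ∂P ≤
      ENNReal.ofReal (Real.exp (η * C) * (1 + 2 * C₂.toReal) * Real.exp (-(η / 32 * ‖toE h‖ ^ α)))
      := by
    refine (lintegral_mono_ae hae).trans ?_
    obtain ⟨v, hv⟩ := hgauss 1 (fun _ => toE h) fun _ => 1
    simp only [Finset.univ_unique, Finset.sum_const, Finset.card_singleton, one_smul,
      one_mul] at hv
    have hGsup (p) : Measurable fun ω => ⨆ n, G p n ω := Measurable.iSup (hGmeas p)
    rw [lintegral_add_left (by have := hmeas (toE h); fun_prop),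
      lintegral_const_mul _ (by have := hmeas (toE h); fun_prop),
      lintegral_const_mul _ (by have := hGsup 0; have := hGsup (toE h); fun_prop),
      lintegral_add_left (hGsup 0),
      lintegral_exp_mul_eq_of_map_eq_gaussianReal (hmeas _) hv, hvar,
      ← ENNReal.ofReal_mul (Real.exp_pos _).le, ← Real.exp_add]
    refine (add_le_add_right (mul_le_mul_right (add_le_add (hGint 0) (hGint (toE h))) _) _).trans ?_
    rw [← ENNReal.ofReal_toReal hC₂, ← ENNReal.ofReal_add (by positivity) (by positivity),
      ← ENNReal.ofReal_mul (by positivity), ← ENNReal.ofReal_add (by positivity) (by positivity),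
      ENNReal.toReal_ofReal (by positivity)]
    refine ENNReal.ofReal_le_ofReal ?_
    have hηC : 0 ≤ η * C := by positivity
    have e1 : Real.exp (-(3 / 16) * s + (1 / 2) ^ 2 / 2 * (η * ‖toE h‖ ^ α)) ≤
        Real.exp (η * C) * Real.exp (-(η / 32 * ‖toE h‖ ^ α)) := by
      rw [← Real.exp_add]
      exact Real.exp_le_exp.2 (by rw [hs]; linarith)
    have e2 : Real.exp (-(1 / 16) * s) ≤
        Real.exp (η * C) * Real.exp (-(η / 32 * ‖toE h‖ ^ α)) := by
      rw [← Real.exp_add]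
      exact Real.exp_le_exp.2 (by rw [hs]; linarith)
    calc _ ≤ _ := add_le_add e1 (mul_le_mul_of_nonneg_right e2
            (add_nonneg ENNReal.toReal_nonneg ENNReal.toReal_nonneg))
      _ = _ := by ring
  have hnonneg (ω) : 0 ≤ min (sSup ((fun x => Y x ω) '' cube (0 : Fin d → ℤ)))
      (sSup ((fun x => Y x ω) '' cube h)) := by
    refine le_min (Real.sSup_nonneg ?_) (Real.sSup_nonneg ?_) <;>
    · rintro _ ⟨x, -, rfl⟩
      simp only [hY]
      positivity
  have hmain : Real.exp (η * C) * (1 + 2 * C₂.toReal) * Real.exp (-(η / 32 * ‖toE h‖ ^ α)) ≤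
      Real.exp (η * C) * (1 + 2 * C₂.toReal) * K * ‖toE h‖ ^ (-b) := by
    rw [mul_assoc _ K]
    exact mul_le_mul_of_nonneg_left (hK _ hpos) (by positivity)
  refine le_trans ?_ hmain
  by_cases hint : Integrable (fun ω => min (sSup ((fun x => Y x ω) '' cube (0 : Fin d → ℤ)))
      (sSup ((fun x => Y x ω) '' cube h))) P
  · rw [← ENNReal.ofReal_le_ofReal_iff (by positivity),
      ofReal_integral_eq_lintegral_ofReal hint (ae_of_all _ hnonneg)]
    exact hlint
  · rw [integral_undef hint]
    positivity

end
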